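/- Let G be a finite p-group and let H ≤ K ≤ G be subgroups with |H| = p^m and |K| = p^{m+1}. Then ψ_H(G) ≤ p · ψ_K(G) − p^m(p − 1). -/

import Mathlib

/-- The order of `x` relative to the subgroup `H`: the smallest positive
integer `k` such that `x ^ k ∈ H`. -/
noncomputable def relOrder {G : Type*} [Group G] (H : Subgroup G) (x : G) : ℕ :=
  sInf {k : ℕ | 0 < k ∧ x ^ k ∈ H}

/-- `ψ_H(G)`: the sum over all elements of `G` of their orders relative to `H`. -/
noncomputable def psiRel (G : Type*) [Group G] (H : Subgroup G) : ℕ :=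
  ∑ᶠ x : G, relOrder H x

/-- `ψ(G)`: the sum of the orders of the elements of `G`. -/
noncomputable def psiSum (G : Type*) [Group G] : ℕ :=
  ∑ᶠ x : G, orderOf x

theorem relOrder_le {G : Type*} [Group G] {H : Subgroup G} {x : G} {k : ℕ}
    (hk : 0 < k) (hx : x ^ k ∈ H) : relOrder H x ≤ k :=
  Nat.sInf_le ⟨hk, hx⟩

theorem relOrder_spec {G : Type*} [Group G] [Finite G] (H : Subgroup G) (x : G) :
    0 < relOrder H x ∧ x ^ relOrder H x ∈ H :=
  Nat.sInf_mem (s := {k : ℕ | 0 < k ∧ x ^ k ∈ H})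
    ⟨orderOf x, orderOf_pos x, by simp [pow_orderOf_eq_one]⟩

theorem relOrder_le_relIndex_mul {G : Type*} [Group G] [Finite G] (H K : Subgroup G) (x : G) :
    relOrder H x ≤ H.relIndex K * relOrder K x := by
  obtain ⟨hpos, hmem⟩ := relOrder_spec K x
  obtain ⟨n, hn, hle, hnH, -⟩ :=
    Subgroup.exists_pow_mem_of_relIndex_ne_zero (H := H) (K := K)
      Subgroup.index_ne_zero_of_finite hmem
  calc relOrder H x ≤ relOrder K x * n :=
        relOrder_le (Nat.mul_pos hpos hn) (by rwa [pow_mul])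
    _ ≤ H.relIndex K * relOrder K x := by
        rw [mul_comm]; exact Nat.mul_le_mul_right _ hle

/-- If `G` is a finite `p`-group and `H ≤ K ≤ G` with `|H| = p ^ m`
and `|K| = p ^ (m + 1)`, then `ψ_H(G) ≤ p * ψ_K(G) - p ^ m * (p - 1)`. -/
theorem psiRel_le_of_pGroup {p m : ℕ} (hp : p.Prime) {G : Type*} [Group G] [Finite G]
    (hG : IsPGroup p G) (H K : Subgroup G) (hHK : H ≤ K)
    (hH : Nat.card H = p ^ m) (hK : Nat.card K = p ^ (m + 1)) :
    (psiRel G H : ℤ) ≤ (p : ℤ) * psiRel G K - (p : ℤ) ^ m * ((p : ℤ) - 1) := by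
  classical
  have := Fintype.ofFinite G
  have hidx : H.relIndex K = p := by
    have h := Subgroup.relIndex_mul_relIndex ⊥ H K bot_le hHK
    rw [Subgroup.relIndex_bot_left, Subgroup.relIndex_bot_left, hH, hK, pow_succ] at h
    exact Nat.eq_of_mul_eq_mul_left (pow_pos hp.pos m) h
  have hpt (x : G) : (relOrder H x : ℤ) + (if x ∈ H then (p : ℤ) - 1 else 0) ≤
      p * relOrder K x := by
    split_ifs with hx
    · have h1 : relOrder H x ≤ 1 := relOrder_le one_pos (by simpa using hx)
      have h2 : p * 1 ≤ p * relOrder K x :=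
        Nat.mul_le_mul_left _ (relOrder_spec K x).1
      zify at h1 h2
      linarith
    · have h := relOrder_le_relIndex_mul H K x
      rw [hidx] at h
      simpa using mod_cast h
  have hcard : ∑ x : G, (if x ∈ H then (p : ℤ) - 1 else 0) = (p : ℤ) ^ m * ((p : ℤ) - 1) := by
    rw [← Finset.sum_filter, Finset.sum_const, ← Fintype.card_subtype, ← Nat.card_eq_fintype_card,
      nsmul_eq_mul]
    exact_mod_cast congrArg (fun n : ℕ => (n : ℤ) * ((p : ℤ) - 1)) hH
  have hsum := Finset.sum_le_sum fun x (_ : x ∈ Finset.univ) => hpt x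
  rw [Finset.sum_add_distrib, hcard, ← Finset.mul_sum] at hsum
  simp only [psiRel, finsum_eq_sum_of_fintype]
  push_cast
  linarith
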